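/- Let R be a subgroup of G. Then the following conditions are equivalent: (1) R is strongly relatively quasi-convex; (2) R is generated by a finite set Y and the natural embedding (R, dist_Y) → (G, dist_{X∪𝓗}) is a quasi-isometric embedding, where dist_Y is the word metric on R with respect to Y. -/

import Mathlib

namespace RelHyp

variable {G : Type*} [Group G] {Λ : Type*}

/-- Length of a shortest word over the alphabet `S ∪ S⁻¹` representing `g`. -/
noncomputable def wordLength (S : Set G) (g : G) : ℕ :=
  sInf {n | ∃ w : List G, w.length = n ∧ (∀ x ∈ w, x ∈ S ∨ x⁻¹ ∈ S) ∧ w.prod = g}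

/-- The free product `F = (∗_λ H_λ) ∗ F(X)`. -/
abbrev RelFree (H : Λ → Subgroup G) (X : Set G) : Type _ :=
  Monoid.Coprod (Monoid.CoprodI fun l => ↥(H l)) (FreeGroup ↥X)

/-- The canonical homomorphism `ε : F → G`. -/
def relEps (H : Λ → Subgroup G) (X : Set G) : RelFree H X →* G :=
  Monoid.Coprod.lift (Monoid.CoprodI.lift fun l => (H l).subtype)
    (FreeGroup.lift fun x => (x : G))

/-- Letters of the alphabet `X ∪ 𝓗`, where `𝓗 = ⊔_λ (H̃_λ ∖ {1})`. -/
abbrev RelLetter (H : Λ → Subgroup G) (X : Set G) : Type _ :=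
  (Σ l : Λ, {h : ↥(H l) // h ≠ 1}) ⊕ (↥X × Bool)

/-- The image of a letter in the free product `F`. -/
def RelLetter.toF {H : Λ → Subgroup G} {X : Set G} : RelLetter H X → RelFree H X
  | Sum.inl ⟨_, h⟩ => Monoid.Coprod.inl (Monoid.CoprodI.of h.1)
  | Sum.inr (x, b) => Monoid.Coprod.inr (if b then FreeGroup.of x else (FreeGroup.of x)⁻¹)

/-- The element of `G` represented by a letter. -/
def RelLetter.val {H : Λ → Subgroup G} {X : Set G} : RelLetter H X → G
  | Sum.inl ⟨_, h⟩ => (h.1 : G)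
  | Sum.inr (x, b) => if b then (x : G) else (x : G)⁻¹

/-- The index `λ` such that the letter belongs to `H̃_λ`, if any. -/
def RelLetter.hIndex {H : Λ → Subgroup G} {X : Set G} : RelLetter H X → Option Λ
  | Sum.inl ⟨l, _⟩ => some l
  | Sum.inr _ => none

/-- The element of `F` represented by a word over `X ∪ 𝓗`. -/
def wordToF {H : Λ → Subgroup G} {X : Set G} (w : List (RelLetter H X)) : RelFree H X :=
  (w.map RelLetter.toF).prod

/-- `f` is a relative isoperimetric function of the relative presentation `⟨X, H | R⟩`. -/
def IsIsoperFn (H : Λ → Subgroup G) (X : Set G) (R : Set (RelFree H X)) (f : ℕ → ℕ) : Prop :=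
  ∀ w : List (RelLetter H X), relEps H X (wordToF w) = 1 →
    ∃ k ≤ f w.length, ∃ r c : Fin k → RelFree H X,
      (∀ i, r i ∈ R) ∧ wordToF w = (List.ofFn fun i => (c i)⁻¹ * r i * c i).prod

/-- `⟨X, H | R⟩` is a finite relative presentation of `G` w.r.t. the collection `H`. -/
structure IsFiniteRelPres (H : Λ → Subgroup G) (X : Set G) (R : Set (RelFree H X)) : Prop where
  finX : X.Finite
  finR : R.Finite
  surj : Function.Surjective (relEps H X)
  ker : (relEps H X).ker = Subgroup.normalClosure R

/-- `G` is finitely presented relative to the collection of subgroups `H`. -/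
def FinitelyPresentedRel (H : Λ → Subgroup G) : Prop :=
  ∃ (X : Set G) (R : Set (RelFree H X)), IsFiniteRelPres H X R

/-- The relative area of a word representing `1`. -/
noncomputable def relArea (H : Λ → Subgroup G) (X : Set G) (R : Set (RelFree H X))
    (w : List (RelLetter H X)) : ℕ :=
  sInf {k | ∃ r c : Fin k → RelFree H X,
    (∀ i, r i ∈ R) ∧ wordToF w = (List.ofFn fun i => (c i)⁻¹ * r i * c i).prod}

/-- The relative Dehn function of the presentation `⟨X, H | R⟩`. -/
noncomputable def relDehn (H : Λ → Subgroup G) (X : Set G) (R : Set (RelFree H X))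
    (n : ℕ) : ℕ :=
  sSup {a | ∃ w : List (RelLetter H X), w.length ≤ n ∧ relEps H X (wordToF w) = 1 ∧
    a = relArea H X R w}

/-- The relative Dehn function is well-defined (finite for each value of the argument),
i.e. there exists a finite-valued relative isoperimetric function. -/
def DehnWellDefined (H : Λ → Subgroup G) (X : Set G) (R : Set (RelFree H X)) : Prop :=
  ∃ f : ℕ → ℕ, IsIsoperFn H X R f

/-- `f ⪯ g`. -/
def AsympLE (f g : ℕ → ℕ) : Prop := ∃ C K L : ℕ, ∀ n, f n ≤ C * g (K * n) + L * n

/-- `f ∼ g`. -/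
def AsympEquiv (f g : ℕ → ℕ) : Prop := AsympLE f g ∧ AsympLE g f

/-- `G` is hyperbolic relative to `H`: it admits a finite relative presentation with a
linear relative isoperimetric function. -/
def IsRelHyperbolic (H : Λ → Subgroup G) : Prop :=
  ∃ (X : Set G) (R : Set (RelFree H X)), IsFiniteRelPres H X R ∧
    ∃ A B : ℕ, IsIsoperFn H X R fun n => A * n + B

/-- The subnegative closure of `f`. -/
noncomputable def subnegClosure (f : ℕ → ℕ) (n : ℕ) : ℕ :=
  sSup {s | ∃ L : List ℕ, (∀ a ∈ L, 0 < a) ∧ L.sum = n ∧ s = (L.map f).sum}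

/-- A combinatorial path in the Cayley graph `Γ(G, X ∪ 𝓗)`: a starting vertex
together with the word labelling the path. -/
structure RelPath (H : Λ → Subgroup G) (X : Set G) where
  start : G
  word : List (RelLetter H X)

namespace RelPath

variable {H : Λ → Subgroup G} {X : Set G}

/-- The length of the path. -/
def len (p : RelPath H X) : ℕ := p.word.length

/-- The `k`-th vertex of the path. -/
def vertex (p : RelPath H X) (k : ℕ) : G :=
  p.start * ((p.word.take k).map RelLetter.val).prod

/-- The terminal vertex of the path. -/
def finish (p : RelPath H X) : G := p.vertex p.word.length

end RelPath

/-- The combinatorial metric `dist_{X ∪ 𝓗}` on `G`. -/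
noncomputable def relDist (H : Λ → Subgroup G) (X : Set G) (g h : G) : ℕ :=
  wordLength (X ∪ ⋃ l, (H l : Set G)) (g⁻¹ * h)

/-- The relative length `|g|_{X ∪ 𝓗}`. -/
noncomputable def relLen (H : Λ → Subgroup G) (X : Set G) (g : G) : ℕ :=
  wordLength (X ∪ ⋃ l, (H l : Set G)) g

/-- The word metric `dist_X` on `G`. -/
noncomputable def xDist (X : Set G) (g h : G) : ℕ := wordLength X (g⁻¹ * h)

variable {H : Λ → Subgroup G} {X : Set G}

/-- `p` is a `(λ, c)`-quasi-geodesic in `Γ(G, X ∪ 𝓗)`. -/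
def IsQuasiGeodesic (lam c : ℝ) (p : RelPath H X) : Prop :=
  ∀ i j : ℕ, i ≤ j → j ≤ p.len →
    ((j - i : ℕ) : ℝ) ≤ lam * (relDist H X (p.vertex i) (p.vertex j) : ℝ) + c

/-- `p` is a geodesic in `Γ(G, X ∪ 𝓗)`. -/
def IsGeodesic (p : RelPath H X) : Prop :=
  ∀ i j : ℕ, i ≤ j → j ≤ p.len → j - i = relDist H X (p.vertex i) (p.vertex j)

/-- The `k`-th letter of `p` is a letter of `H̃_l`. -/
def LetterIsH (p : RelPath H X) (l : Λ) (k : ℕ) : Prop :=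
  ∃ a, p.word[k]? = some a ∧ a.hIndex = some l

/-- The subpath of `p` consisting of the letters with indices `a, …, b` is an
`H_l`-component of `p` (a maximal nonempty `H_l`-subword). -/
def IsComponent (p : RelPath H X) (l : Λ) (a b : ℕ) : Prop :=
  a ≤ b ∧ b < p.len ∧ (∀ k, a ≤ k → k ≤ b → LetterIsH p l k) ∧
    (a = 0 ∨ ¬ LetterIsH p l (a - 1)) ∧ (b + 1 = p.len ∨ ¬ LetterIsH p l (b + 1))

/-- The `H_l`-components of `p` starting at index `a` and of `q` starting at `a'`
are connected (their vertices lie in the same left coset of `H_l`). -/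
def ConnectedComp (p q : RelPath H X) (l : Λ) (a a' : ℕ) : Prop :=
  (p.vertex a)⁻¹ * q.vertex a' ∈ H l

/-- `p` is a path without backtracking: all of its components are isolated. -/
def NoBacktracking (p : RelPath H X) : Prop :=
  ∀ l a b a' b', IsComponent p l a b → IsComponent p l a' b' →
    ConnectedComp p p l a a' → a = a' ∧ b = b'

/-- The `k`-th vertex of `p` is a phase vertex (not an inner vertex of a component). -/
def IsPhase (p : RelPath H X) (k : ℕ) : Prop :=
  ¬ ∃ l a b, IsComponent p l a b ∧ a < k ∧ k ≤ b

/-- `p` and `q` are `k`-similar: their endpoints are `X`-distance at most `k` apart. -/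
def Similar (k : ℝ) (p q : RelPath H X) : Prop :=
  (xDist X p.start q.start : ℝ) ≤ k ∧ (xDist X p.finish q.finish : ℝ) ≤ k

/-- The Rips thin-triangles condition for `Γ(G, X ∪ 𝓗)` with constant `δ`. -/
def RipsThin (H : Λ → Subgroup G) (X : Set G) (δ : ℝ) : Prop :=
  ∀ p q r : RelPath H X, IsGeodesic p → IsGeodesic q → IsGeodesic r →
    p.finish = q.start → q.finish = r.start → r.finish = p.start →
    ∀ i ≤ p.len, ∃ j : ℕ,
      (j ≤ q.len ∧ (relDist H X (p.vertex i) (q.vertex j) : ℝ) ≤ δ) ∨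
      (j ≤ r.len ∧ (relDist H X (p.vertex i) (r.vertex j) : ℝ) ≤ δ)

/-- The Cayley graph `Γ(G, X ∪ 𝓗)` is a hyperbolic metric space. -/
def CayleyHyperbolic (H : Λ → Subgroup G) (X : Set G) : Prop :=
  ∃ δ : ℝ, 0 ≤ δ ∧ RipsThin H X δ

/-- `R` is a relatively quasi-convex subgroup of `G`. -/
def RelQuasiconvex (H : Λ → Subgroup G) (X : Set G) (R : Subgroup G) : Prop :=
  ∃ σ : ℝ, 0 < σ ∧ ∀ p : RelPath H X, IsGeodesic p → p.start ∈ R → p.finish ∈ R →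
    ∀ k ≤ p.len, ∃ w ∈ R, (xDist X (p.vertex k) w : ℝ) ≤ σ

/-- `R` is a strongly relatively quasi-convex subgroup of `G`. -/
def StronglyRelQuasiconvex (H : Λ → Subgroup G) (X : Set G) (R : Subgroup G) : Prop :=
  RelQuasiconvex H X R ∧ ∀ (g : G) (l : Λ), {x : G | x ∈ R ∧ g * x * g⁻¹ ∈ H l}.Finite

/-- `g` is a hyperbolic element: it is not conjugate to an element of any `H_λ`. -/
def IsHypElt (H : Λ → Subgroup G) (g : G) : Prop :=
  ∀ l : Λ, ∀ x ∈ H l, ¬ IsConj g x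

end RelHyp

open RelHyp

namespace RelHyp

section WordLength

variable {G : Type*} [Group G] {S : Set G}

lemma wordLength_le {w : List G} (hw : ∀ x ∈ w, x ∈ S ∨ x⁻¹ ∈ S) :
    wordLength S w.prod ≤ w.length :=
  Nat.sInf_le ⟨w, rfl, hw, rfl⟩

lemma exists_word_of_mem_closure {g : G} (hg : g ∈ Subgroup.closure S) :
    ∃ w : List G, w.length = wordLength S g ∧ (∀ x ∈ w, x ∈ S ∨ x⁻¹ ∈ S) ∧ w.prod = g := by
  rw [← Subgroup.mem_toSubmonoid, Subgroup.closure_toSubmonoid] at hg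
  obtain ⟨w, hw, hp⟩ := Submonoid.exists_list_of_mem_closure hg
  exact Nat.sInf_mem (s := {n | ∃ w : List G, w.length = n ∧
    (∀ x ∈ w, x ∈ S ∨ x⁻¹ ∈ S) ∧ w.prod = g}) ⟨_, w, rfl, hw, hp⟩

@[simp] lemma wordLength_one : wordLength S 1 = 0 := by
  simpa using wordLength_le (S := S) (w := []) (by simp)

lemma wordLength_le_one {g : G} (hg : g ∈ S ∨ g⁻¹ ∈ S) : wordLength S g ≤ 1 := by
  simpa using wordLength_le (S := S) (w := [g]) (by simpa using hg)

lemma wordLength_mul_le {g h : G} (hg : g ∈ Subgroup.closure S) (hh : h ∈ Subgroup.closure S) :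
    wordLength S (g * h) ≤ wordLength S g + wordLength S h := by
  obtain ⟨w, hwl, hw, rfl⟩ := exists_word_of_mem_closure hg
  obtain ⟨v, hvl, hv, rfl⟩ := exists_word_of_mem_closure hh
  rw [← hwl, ← hvl, ← List.prod_append, ← List.length_append]
  refine wordLength_le fun x hx => ?_
  rcases List.mem_append.1 hx with h | h
  exacts [hw x h, hv x h]

lemma wordLength_inv_le {g : G} (hg : g ∈ Subgroup.closure S) :
    wordLength S g⁻¹ ≤ wordLength S g := by
  obtain ⟨w, hwl, hw, rfl⟩ := exists_word_of_mem_closure hg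
  rw [List.prod_inv_reverse, ← hwl]
  refine (wordLength_le (S := S) fun x hx => ?_).trans (by simp)
  simp only [List.mem_reverse, List.mem_map] at hx
  obtain ⟨y, hy, rfl⟩ := hx
  simpa [or_comm] using hw y hy

lemma wordLength_inv {g : G} (hg : g ∈ Subgroup.closure S) :
    wordLength S g⁻¹ = wordLength S g :=
  le_antisymm (wordLength_inv_le hg) <| by
    simpa using wordLength_inv_le (inv_mem hg)

lemma wordLength_anti {T : Set G} (hST : S ⊆ T) {g : G} (hg : g ∈ Subgroup.closure S) :
    wordLength T g ≤ wordLength S g := by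
  obtain ⟨w, hwl, hw, rfl⟩ := exists_word_of_mem_closure hg
  rw [← hwl]
  exact wordLength_le fun x hx => (hw x hx).imp (@hST _) (@hST _)

lemma finite_wordLength_le (hS : S.Finite) (n : ℕ) :
    {g | g ∈ Subgroup.closure S ∧ wordLength S g ≤ n}.Finite := by
  have hT : (S ∪ S⁻¹).Finite := hS.union hS.inv
  refine ((List.finite_length_le (hT.toFinset : Type _) n).image
    fun w => (w.map Subtype.val).prod).subset ?_
  rintro g ⟨hg, hn⟩
  obtain ⟨w, hwl, hw, rfl⟩ := exists_word_of_mem_closure hg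
  refine ⟨w.attach.map fun x => ⟨x.1, by simpa using hw x.1 x.2⟩, ?_, ?_⟩
  · simpa [hwl] using hn
  · simp [Function.comp_def]

end WordLength

section RelDist

variable {G : Type*} [Group G] {Λ : Type*} {H : Λ → Subgroup G} {X : Set G}

lemma closure_union_eq_top (hX : Subgroup.closure X = ⊤) :
    Subgroup.closure (X ∪ ⋃ l, (H l : Set G)) = ⊤ :=
  top_le_iff.1 <| hX ▸ Subgroup.closure_mono Set.subset_union_left

@[simp] lemma relDist_self (g : G) : relDist H X g g = 0 := by simp [relDist]

lemma relDist_comm (hX : Subgroup.closure X = ⊤) (g h : G) :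
    relDist H X g h = relDist H X h g := by
  rw [relDist, relDist, ← wordLength_inv (by rw [closure_union_eq_top hX]; trivial)]
  simp

lemma relDist_triangle (hX : Subgroup.closure X = ⊤) (a b c : G) :
    relDist H X a c ≤ relDist H X a b + relDist H X b c := by
  have := wordLength_mul_le (S := X ∪ ⋃ l, (H l : Set G)) (g := a⁻¹ * b) (h := b⁻¹ * c)
    (by rw [closure_union_eq_top hX]; trivial) (by rw [closure_union_eq_top hX]; trivial)
  simpa [relDist, mul_assoc] using this

lemma relDist_mul_le_wordLength (hX : Subgroup.closure X = ⊤) (g k : G) :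
    relDist H X g (g * k) ≤ wordLength X k := by
  rw [relDist, inv_mul_cancel_left]
  exact wordLength_anti Set.subset_union_left (by rw [hX]; trivial)

lemma relDist_mul_le_one {l : Λ} {h : G} (hh : h ∈ H l) (g : G) :
    relDist H X g (g * h) ≤ 1 := by
  rw [relDist, inv_mul_cancel_left]
  exact wordLength_le_one <| .inl <| .inr <| Set.mem_iUnion.2 ⟨l, hh⟩

lemma RelLetter.val_mem (a : RelLetter H X) :
    a.val ∈ X ∨ a.val⁻¹ ∈ X ∨ ∃ l, a.val ∈ H l := by
  rcases a with ⟨l, h⟩ | ⟨x, b⟩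
  · exact .inr (.inr ⟨l, h.1.2⟩)
  · cases b <;> simp [RelLetter.val]

lemma RelLetter.val_mem_union (a : RelLetter H X) :
    a.val ∈ X ∪ ⋃ l, (H l : Set G) ∨ a.val⁻¹ ∈ X ∪ ⋃ l, (H l : Set G) := by
  rcases a.val_mem with h | h | ⟨l, h⟩
  exacts [.inl (.inl h), .inr (.inl h), .inl (.inr (Set.mem_iUnion.2 ⟨l, h⟩))]

lemma exists_relLetter {g : G}
    (hg : g ∈ X ∪ ⋃ l, (H l : Set G) ∨ g⁻¹ ∈ X ∪ ⋃ l, (H l : Set G)) :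
    g = 1 ∨ ∃ a : RelLetter H X, a.val = g := by
  by_cases h1 : g = 1
  · exact .inl h1
  refine .inr ?_
  have key : g ∈ X ∨ g⁻¹ ∈ X ∨ ∃ l, g ∈ H l := by
    simp only [Set.mem_union, Set.mem_iUnion, SetLike.mem_coe, inv_mem_iff] at hg
    grind
  rcases key with h | h | ⟨l, h⟩
  · exact ⟨.inr (⟨g, h⟩, true), by simp [RelLetter.val]⟩
  · exact ⟨.inr (⟨g⁻¹, h⟩, false), by simp [RelLetter.val]⟩
  · exact ⟨.inl ⟨l, ⟨g, h⟩, by simpa [Subtype.ext_iff] using h1⟩, rfl⟩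

lemma exists_relWord (w : List G)
    (hw : ∀ x ∈ w, x ∈ X ∪ ⋃ l, (H l : Set G) ∨ x⁻¹ ∈ X ∪ ⋃ l, (H l : Set G)) :
    ∃ v : List (RelLetter H X), v.length ≤ w.length ∧ (v.map RelLetter.val).prod = w.prod := by
  induction w with
  | nil => exact ⟨[], by simp⟩
  | cons x w ih =>
    obtain ⟨v, hv, hp⟩ := ih fun y hy => hw y (List.mem_cons_of_mem _ hy)
    rcases exists_relLetter (hw x List.mem_cons_self) with rfl | ⟨a, rfl⟩
    · exact ⟨v, by simp; omega, by simp [hp]⟩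
    · exact ⟨a :: v, by simpa using hv, by simp [hp]⟩

namespace RelPath

variable (p : RelPath H X)

@[simp] lemma vertex_zero : p.vertex 0 = p.start := by simp [vertex]

lemma vertex_succ {k : ℕ} (hk : k < p.len) :
    p.vertex (k + 1) = p.vertex k * (p.word[k]'hk).val := by
  have hk' : k < p.word.length := hk
  rw [vertex, vertex, List.take_add_one, List.getElem?_eq_getElem hk', Option.toList_some,
    List.map_append, List.prod_append, mul_assoc]
  simp
  rfl

lemma relDist_vertex_succ_le {k : ℕ} (hk : k < p.len) :
    relDist H X (p.vertex k) (p.vertex (k + 1)) ≤ 1 := by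
  rw [p.vertex_succ hk, relDist, inv_mul_cancel_left]
  exact wordLength_le_one (RelLetter.val_mem_union _)

lemma relDist_vertex_le (hX : Subgroup.closure X = ⊤) {i j : ℕ} (hij : i ≤ j)
    (hj : j ≤ p.len) : relDist H X (p.vertex i) (p.vertex j) ≤ j - i := by
  induction j, hij using Nat.le_induction with
  | base => simp
  | succ j hij ih =>
    have h1 := ih (by omega)
    have h2 := p.relDist_vertex_succ_le (k := j) (by omega)
    have h3 := relDist_triangle (H := H) hX (p.vertex i) (p.vertex j) (p.vertex (j + 1))
    omega

end RelPath

lemma exists_geodesic (hX : Subgroup.closure X = ⊤) (g h : G) :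
    ∃ p : RelPath H X, IsGeodesic p ∧ p.start = g ∧ p.finish = h ∧ p.len = relDist H X g h := by
  obtain ⟨w, hwl, hw, hp⟩ := exists_word_of_mem_closure
    (S := X ∪ ⋃ l, (H l : Set G)) (g := g⁻¹ * h) (by rw [closure_union_eq_top hX]; trivial)
  obtain ⟨v, hv, hvp⟩ := exists_relWord w hw
  let p : RelPath H X := ⟨g, v⟩
  have hfin : p.vertex p.len = h := by simp [p, RelPath.vertex, RelPath.len, hvp, hp]
  have hle : p.len ≤ relDist H X g h := hv.trans hwl.le
  have hsub : ∀ i j, i ≤ j → j ≤ p.len →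
      relDist H X (p.vertex i) (p.vertex j) ≤ j - i :=
    fun i j hij hj => p.relDist_vertex_le hX hij hj
  refine ⟨p, fun i j hij hj => ?_, rfl, hfin, ?_⟩
  · have h1 := hsub 0 i (by omega) (by omega)
    have h2 := hsub i j hij hj
    have h3 := hsub j p.len hj le_rfl
    have h4 := relDist_triangle (H := H) hX g (p.vertex i) h
    have h5 := relDist_triangle (H := H) hX (p.vertex i) (p.vertex j) h
    rw [RelPath.vertex_zero] at h1
    rw [hfin] at h3
    change relDist H X g _ ≤ _ at h1
    omega
  · have := hsub 0 p.len (by omega) le_rfl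
    rw [RelPath.vertex_zero, hfin] at this
    change relDist H X g _ ≤ _ at this
    omega

end RelDist

section Forward

variable {G : Type*} [Group G] {Λ : Type*} {H : Λ → Subgroup G} {X : Set G}

lemma finite_inter_double_translate {R : Subgroup G} {l : Λ} {u v : G}
    (h : {x : G | x ∈ R ∧ u * x * u⁻¹ ∈ H l}.Finite) :
    {y : G | y ∈ R ∧ u * y * v⁻¹ ∈ H l}.Finite := by
  rcases Set.eq_empty_or_nonempty {y : G | y ∈ R ∧ u * y * v⁻¹ ∈ H l} with h0 | ⟨z, hz, hz'⟩
  · rw [h0]; exact Set.finite_empty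
  refine (h.image (· * z)).subset fun y ⟨hy, hy'⟩ => ⟨y * z⁻¹, ⟨R.mul_mem hy (R.inv_mem hz), ?_⟩,
    by simp⟩
  have := (H l).mul_mem hy' ((H l).inv_mem hz')
  simpa [mul_assoc] using this

lemma relDist_one_le_mul_wordLength (hX : Subgroup.closure X = ⊤) {Y : Set G} {C : ℕ}
    (hC : ∀ y ∈ Y, relDist H X 1 y ≤ C) {g : G} (hg : g ∈ Subgroup.closure Y) :
    relDist H X 1 g ≤ C * wordLength Y g := by
  obtain ⟨w, hwl, hw, rfl⟩ := exists_word_of_mem_closure hg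
  rw [← hwl]
  clear hwl hg
  induction w with
  | nil => simp
  | cons x w ih =>
    have h1 := ih fun y hy => hw y (List.mem_cons_of_mem _ hy)
    have h2 : relDist H X 1 x ≤ C := by
      rcases hw x List.mem_cons_self with h | h
      · exact hC x h
      · have := hC _ h
        rw [relDist_comm hX] at this
        simpa [relDist] using this
    have h3 := relDist_triangle (H := H) hX 1 x (x * w.prod)
    have h4 : relDist H X x (x * w.prod) = relDist H X 1 w.prod := by simp [relDist]
    simp only [List.prod_cons, List.length_cons]
    nlinarith

lemma StronglyRelQuasiconvex.exists_quasiIsometricEmbedding [Finite Λ]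
    (hXfin : X.Finite) (hX : Subgroup.closure X = ⊤) {R : Subgroup G}
    (hR : StronglyRelQuasiconvex H X R) :
    ∃ Y : Set G, Y.Finite ∧ Y ⊆ (R : Set G) ∧ Subgroup.closure Y = R ∧
      ∃ c₁ c₂ : ℝ, 0 < c₁ ∧ 0 ≤ c₂ ∧
        ∀ a ∈ R, ∀ b ∈ R,
          (1 / c₁) * (wordLength Y (a⁻¹ * b) : ℝ) - c₂ ≤ (relDist H X a b : ℝ) ∧
          (relDist H X a b : ℝ) ≤ c₁ * (wordLength Y (a⁻¹ * b) : ℝ) + c₂ := by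
  obtain ⟨⟨σ, -, hσ⟩, hfin⟩ := hR
  let B : Set G := {g | g ∈ Subgroup.closure X ∧ wordLength X g ≤ ⌊σ⌋₊}
  have hB : B.Finite := finite_wordLength_le hXfin _
  let Y : Set G := ⋃ u ∈ B, ⋃ v ∈ B,
    ({y | y ∈ R ∧ u * y * v⁻¹ ∈ X ∪ X⁻¹} ∪ ⋃ l, {y | y ∈ R ∧ u * y * v⁻¹ ∈ H l})
  have hY : Y.Finite := by
    refine hB.biUnion fun u _ => hB.biUnion fun v _ => Set.Finite.union ?_ ?_
    · refine ((hXfin.union hXfin.inv).image fun x => u⁻¹ * x * v).subset ?_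
      rintro y ⟨-, hy⟩
      exact ⟨_, hy, by group⟩
    · exact Set.finite_iUnion fun l => finite_inter_double_translate (hfin u l)
  have hYR : Y ⊆ (R : Set G) := by
    intro y hy
    simp only [Y, Set.mem_iUnion, Set.mem_union] at hy
    obtain ⟨u, -, v, -, h | ⟨l, h⟩⟩ := hy
    exacts [h.1, h.1]
  have hword : ∀ r ∈ R, ∃ w : List G, w.length = relDist H X 1 r ∧ (∀ x ∈ w, x ∈ Y) ∧
      w.prod = r := by
    intro r hr
    obtain ⟨p, hp, hs, hf, hl⟩ := exists_geodesic (H := H) hX 1 r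
    have hf' : p.vertex p.len = r := hf
    have hnear : ∀ k, ∃ u ∈ R, k ≤ p.len → (p.vertex k)⁻¹ * u ∈ B := by
      intro k
      by_cases hk : k ≤ p.len
      · obtain ⟨u, hu, h⟩ := hσ p hp (hs ▸ R.one_mem) (hf ▸ hr) k hk
        exact ⟨u, hu, fun _ => ⟨by rw [hX]; trivial, Nat.le_floor h⟩⟩
      · exact ⟨1, R.one_mem, fun h => absurd h hk⟩
    choose u huR huB using hnear
    have h1B : (1 : G) ∈ B := ⟨one_mem _, by simp⟩
    let z : ℕ → G := fun k => if k = 0 then 1 else if k = p.len then r else u k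
    have hzR : ∀ k, z k ∈ R := by
      intro k
      simp only [z]
      split_ifs
      exacts [R.one_mem, hr, huR k]
    have hzB : ∀ k ≤ p.len, (p.vertex k)⁻¹ * z k ∈ B := by
      intro k hk
      simp only [z]
      split_ifs with h0 h1
      · simpa [h0, hs] using h1B
      · simpa [h1, hf'] using h1B
      · exact huB k hk
    have hz0 : z 0 = 1 := by simp [z]
    have hzl : z p.len = r := by
      simp only [z]
      split_ifs with h0
      · rw [← hf', h0, RelPath.vertex_zero, hs]
      · rfl
    have hzY : ∀ k < p.len, (z k)⁻¹ * z (k + 1) ∈ Y := by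
      intro k hk
      simp only [Y, Set.mem_iUnion]
      refine ⟨_, hzB k hk.le, _, hzB (k + 1) hk, ?_⟩
      have hmem := R.mul_mem (R.inv_mem (hzR k)) (hzR (k + 1))
      have hval : (p.vertex k)⁻¹ * z k * ((z k)⁻¹ * z (k + 1)) *
          ((p.vertex (k + 1))⁻¹ * z (k + 1))⁻¹ = (p.word[k]'hk).val := by
        rw [p.vertex_succ hk]
        group
      simp only [Set.mem_union, Set.mem_iUnion, Set.mem_ofPred_eq, hval, hmem, true_and,
        Set.mem_inv]
      simpa [or_assoc] using RelLetter.val_mem (p.word[k]'hk)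
    refine ⟨List.ofFn fun k : Fin p.len => (z k)⁻¹ * z (k + 1), by simp [hl], ?_, ?_⟩
    · intro x hx
      obtain ⟨k, rfl⟩ := (List.mem_ofFn' _ _).1 hx
      exact hzY k k.2
    · have htel : ∀ n, (List.ofFn fun k : Fin n => (z k)⁻¹ * z (k + 1)).prod = z n := by
        intro n
        induction n with
        | zero => simp [hz0]
        | succ n ih =>
          rw [List.ofFn_succ', List.concat_eq_append, List.prod_append]
          simpa using congrArg (· * ((z n)⁻¹ * z (n + 1))) ih
      rw [htel, hzl]
  have hcl : Subgroup.closure Y = R := by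
    refine le_antisymm ((Subgroup.closure_le _).2 hYR) fun r hr => ?_
    obtain ⟨w, -, hw, rfl⟩ := hword r hr
    exact Subgroup.list_prod_mem _ fun x hx => Subgroup.subset_closure (hw x hx)
  obtain ⟨C, hC⟩ := (hY.image (relDist H X 1)).bddAbove
  have hC' : ∀ y ∈ Y, relDist H X 1 y ≤ C + 1 := fun y hy =>
    (hC ⟨y, hy, rfl⟩).trans (Nat.le_succ _)
  refine ⟨Y, hY, hYR, hcl, (C + 1 : ℕ), 0, by positivity, le_rfl, fun a ha b hb => ?_⟩
  have hab := R.mul_mem (R.inv_mem ha) hb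
  have heq : relDist H X a b = relDist H X 1 (a⁻¹ * b) := by simp [relDist]
  constructor
  · obtain ⟨w, hl, hw, hp⟩ := hword _ hab
    have h1 : wordLength Y (a⁻¹ * b) ≤ relDist H X a b := by
      rw [heq, ← hl, ← hp]
      exact wordLength_le fun x hx => .inl (hw x hx)
    have h2 : (1 : ℝ) / (C + 1 : ℕ) ≤ 1 := by
      rw [div_le_one (by positivity)]
      exact_mod_cast Nat.le_add_left 1 C
    have h3 : (wordLength Y (a⁻¹ * b) : ℝ) ≤ relDist H X a b := by exact_mod_cast h1
    have h4 : (0 : ℝ) ≤ wordLength Y (a⁻¹ * b) := by positivity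
    nlinarith
  · rw [heq, add_zero]
    exact_mod_cast relDist_one_le_mul_wordLength hX hC' (hcl ▸ hab)

end Forward

/-- Pairs of an element of `G` and a function on `G`, multiplied as the values of
path-additive functions: `(k, φ) * (k', φ') = (k * k', g ↦ φ g + φ' (g * k))`. -/
@[ext] structure PathSum (G : Type*) where
  /-- The displacement of the path. -/
  disp : G
  /-- The sum along the path, as a function of its starting point. -/
  sum : G → ℝ

namespace PathSum

variable {G : Type*} [Group G]

instance : Mul (PathSum G) := ⟨fun a b => ⟨a.disp * b.disp, fun g => a.sum g + b.sum (g * a.disp)⟩⟩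

instance : One (PathSum G) := ⟨⟨1, fun _ => 0⟩⟩

instance : Inv (PathSum G) := ⟨fun a => ⟨a.disp⁻¹, fun g => -a.sum (g * a.disp⁻¹)⟩⟩

@[simp] lemma mul_disp (a b : PathSum G) : (a * b).disp = a.disp * b.disp := rfl

@[simp] lemma mul_sum (a b : PathSum G) (g : G) :
    (a * b).sum g = a.sum g + b.sum (g * a.disp) := rfl

@[simp] lemma one_disp : (1 : PathSum G).disp = 1 := rfl

@[simp] lemma one_sum (g : G) : (1 : PathSum G).sum g = 0 := rfl

@[simp] lemma inv_disp (a : PathSum G) : a⁻¹.disp = a.disp⁻¹ := rfl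

@[simp] lemma inv_sum (a : PathSum G) (g : G) : a⁻¹.sum g = -a.sum (g * a.disp⁻¹) := rfl

instance : Group (PathSum G) := Group.ofLeftAxioms
  (fun a b c => by ext <;> simp [mul_assoc, add_assoc])
  (fun a => by ext <;> simp)
  (fun a => by ext <;> simp)

end PathSum

section Flow

variable {G : Type*} [Group G] {Λ : Type*} (H : Λ → Subgroup G) (X : Set G)

/-- `ρ` and `f` are functions on `G` which vary in a controlled way under right translations and
`F l` is an extension of `f` to the cosets of `H l`. -/
structure IsTame (L : G → ℝ) (ρ f : G → ℝ) (F : Λ → G → ℝ) : Prop where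
  weight : ∀ g k, |ρ (g * k) - ρ g| ≤ L k
  height : ∀ g k, |f (g * k) - f g| ≤ L k
  cone : ∀ l g, |F l g - f g| ≤ 1
  cone_mul : ∀ l g, ∀ h ∈ H l, F l (g * h) = F l g

/-- The homomorphism integrating the discrete one-form `ρ df` along paths. -/
noncomputable def flow (ρ f : G → ℝ) (F : Λ → G → ℝ) : RelFree H X →* PathSum G :=
  Monoid.Coprod.lift
    (Monoid.CoprodI.lift fun l =>
      { toFun := fun h => ⟨h, fun g => ρ g * (F l g - f g) - ρ (g * h) * (F l (g * h) - f (g * h))⟩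
        map_one' := by ext <;> simp
        map_mul' := fun a b => by ext <;> simp [mul_assoc] })
    (FreeGroup.lift fun x => ⟨x, fun g => ρ g * (f (g * x) - f g)⟩)

variable {H X}

lemma flow_per (ρ f : G → ℝ) (F : Λ → G → ℝ) (l : Λ) (h : H l) :
    flow H X ρ f F (Monoid.Coprod.inl (Monoid.CoprodI.of h)) =
      ⟨h, fun g => ρ g * (F l g - f g) - ρ (g * h) * (F l (g * h) - f (g * h))⟩ := by
  simp [flow]

lemma flow_gen (ρ f : G → ℝ) (F : Λ → G → ℝ) (x : X) :
    flow H X ρ f F (Monoid.Coprod.inr (FreeGroup.of x)) =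
      ⟨x, fun g => ρ g * (f (g * x) - f g)⟩ := by
  simp [flow]

lemma RelFree.induction {P : RelFree H X → Prop}
    (per : ∀ (l : Λ) (h : H l), P (Monoid.Coprod.inl (Monoid.CoprodI.of h)))
    (gen : ∀ x : X, P (Monoid.Coprod.inr (FreeGroup.of x)))
    (one : P 1) (mul : ∀ a b, P a → P b → P (a * b)) (inv : ∀ a, P a → P a⁻¹)
    (e : RelFree H X) : P e := by
  induction e using Monoid.Coprod.induction_on with
  | inl m =>
    induction m using Monoid.CoprodI.induction_on with
    | one => simpa using one
    | of l h => exact per l h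
    | mul a b ha hb => simpa using mul _ _ ha hb
  | inr n =>
    induction n using FreeGroup.induction_on with
    | C1 => simpa using one
    | of x => exact gen x
    | inv_of x h => simpa using inv _ h
    | mul a b ha hb => simpa using mul _ _ ha hb
  | mul a b ha hb => exact mul _ _ ha hb

lemma flow_disp (ρ f : G → ℝ) (F : Λ → G → ℝ) (e : RelFree H X) :
    (flow H X ρ f F e).disp = relEps H X e := by
  induction e using RelFree.induction with
  | per l h => simp [flow_per, relEps]
  | gen x => simp [flow_gen, relEps]
  | one => simp
  | mul a b ha hb => simp [ha, hb]
  | inv a ha => simp [ha]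

lemma flow_approx (L : G → ℝ) (e : RelFree H X) :
    ∃ M : ℝ, ∀ ρ f F, IsTame H L ρ f F → ∀ g,
      |(flow H X ρ f F e).sum g - ρ g * (f (g * relEps H X e) - f g)| ≤ M := by
  induction e using RelFree.induction with
  | per l h =>
    refine ⟨L h * 1, fun ρ f F hT g => ?_⟩
    have h1 : relEps H X (Monoid.Coprod.inl (Monoid.CoprodI.of h)) = h := by simp [relEps]
    have h2 := hT.cone l (g * h)
    have h3 := hT.weight g h
    rw [h1, flow_per]
    simp only [hT.cone_mul l g h h.2]
    rw [hT.cone_mul l g h h.2] at h2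
    calc _ = |-((ρ (g * h) - ρ g) * (F l g - f (g * h)))| := by congr 1; ring
      _ ≤ _ := by
        rw [abs_neg, abs_mul]
        exact mul_le_mul h3 h2 (abs_nonneg _) ((abs_nonneg _).trans h3)
  | gen x =>
    refine ⟨0, fun ρ f F _ g => ?_⟩
    simp [flow_gen, relEps]
  | one => exact ⟨0, fun ρ f F _ g => by simp⟩
  | mul a b ha hb =>
    obtain ⟨M, hM⟩ := ha
    obtain ⟨N, hN⟩ := hb
    refine ⟨M + N + L (relEps H X a) * L (relEps H X b), fun ρ f F hT g => ?_⟩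
    have h1 := hM ρ f F hT g
    have h2 := hN ρ f F hT (g * relEps H X a)
    have h3 := hT.weight g (relEps H X a)
    have h4 := hT.height (g * relEps H X a) (relEps H X b)
    have h5 : |(ρ (g * relEps H X a) - ρ g) *
        (f (g * relEps H X a * relEps H X b) - f (g * relEps H X a))| ≤
        L (relEps H X a) * L (relEps H X b) := by
      rw [abs_mul]
      exact mul_le_mul h3 h4 (abs_nonneg _) ((abs_nonneg _).trans h3)
    rw [map_mul, map_mul, PathSum.mul_sum, flow_disp, ← mul_assoc]
    rw [abs_le] at *
    constructor <;> linarith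
  | inv a ha =>
    obtain ⟨M, hM⟩ := ha
    refine ⟨M + L (relEps H X a)⁻¹ * L (relEps H X a), fun ρ f F hT g => ?_⟩
    have h1 := hM ρ f F hT (g * (relEps H X a)⁻¹)
    have h3 := hT.weight g (relEps H X a)⁻¹
    have h4 := hT.height (g * (relEps H X a)⁻¹) (relEps H X a)
    have h5 : |(ρ (g * (relEps H X a)⁻¹) - ρ g) *
        (f (g * (relEps H X a)⁻¹ * relEps H X a) - f (g * (relEps H X a)⁻¹))| ≤
        L (relEps H X a)⁻¹ * L (relEps H X a) := by
      rw [abs_mul]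
      exact mul_le_mul h3 h4 (abs_nonneg _) ((abs_nonneg _).trans h3)
    rw [map_inv, map_inv, PathSum.inv_sum, flow_disp]
    simp only [inv_mul_cancel_right] at h1 h5
    rw [abs_le] at *
    constructor <;> linarith

lemma flow_prod_conj_le {Rl : Set (RelFree H X)} (hRl : Rl ⊆ (relEps H X).ker)
    {ρ f : G → ℝ} {F : Λ → G → ℝ} {N : ℝ} (hN : ∀ r ∈ Rl, ∀ g, |(flow H X ρ f F r).sum g| ≤ N)
    (w : List (RelFree H X)) (hw : ∀ e ∈ w, ∃ r ∈ Rl, ∃ c, e = c⁻¹ * r * c) (g : G) :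
    |(flow H X ρ f F w.prod).sum g| ≤ N * w.length := by
  induction w with
  | nil => simp
  | cons e w ih =>
    obtain ⟨r, hr, c, rfl⟩ := hw e List.mem_cons_self
    have h1 := ih fun e he => hw e (List.mem_cons_of_mem _ he)
    have h2 := hN r hr (g * (relEps H X c)⁻¹)
    have h3 : relEps H X r = 1 := hRl hr
    have h4 : (flow H X ρ f F (c⁻¹ * r * c)).sum g =
        (flow H X ρ f F r).sum (g * (relEps H X c)⁻¹) := by
      simp [flow_disp, h3]
    rw [List.prod_cons, map_mul, PathSum.mul_sum, h4, flow_disp]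
    simp only [map_mul, map_inv, h3, mul_one, inv_mul_cancel, List.length_cons, Nat.cast_add,
      Nat.cast_one]
    rw [abs_le] at *
    constructor <;> linarith

lemma wordToF_append (v w : List (RelLetter H X)) :
    wordToF (v ++ w) = wordToF v * wordToF w := by
  simp [wordToF]

lemma exists_wordToF (e : RelFree H X) : ∃ w : List (RelLetter H X), wordToF w = e := by
  suffices h : (∃ w : List (RelLetter H X), wordToF w = e) ∧
      ∃ w : List (RelLetter H X), wordToF w = e⁻¹ from h.1
  induction e using RelFree.induction with
  | per l h =>
    have key : ∀ h : H l, ∃ w : List (RelLetter H X),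
        wordToF w = Monoid.Coprod.inl (Monoid.CoprodI.of (M := fun l => H l) h) := by
      intro h
      by_cases h1 : h = 1
      · exact ⟨[], by simp [wordToF, h1]⟩
      · exact ⟨[.inl ⟨l, h, h1⟩], by simp [wordToF, RelLetter.toF]⟩
    refine ⟨key h, ?_⟩
    simpa using key h⁻¹
  | gen x =>
    exact ⟨⟨[.inr (x, true)], by simp [wordToF, RelLetter.toF]⟩,
      ⟨[.inr (x, false)], by simp [wordToF, RelLetter.toF]⟩⟩
  | one => exact ⟨⟨[], by simp [wordToF]⟩, ⟨[], by simp [wordToF]⟩⟩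
  | mul a b ha hb =>
    obtain ⟨⟨u, hu⟩, ⟨u', hu'⟩⟩ := ha
    obtain ⟨⟨v, hv⟩, ⟨v', hv'⟩⟩ := hb
    exact ⟨⟨u ++ v, by simp [wordToF_append, hu, hv]⟩,
      ⟨v' ++ u', by simp [wordToF_append, hu', hv']⟩⟩
  | inv a ha => exact ⟨ha.2, by simpa using ha.1⟩

/-- `Route H Z ρ f F g g' n s`: there is a path of length `n` from `g` to `g'`, with steps in
`Z` or in some `H l`, along which the discrete one-form `ρ df` sums up to `s`. -/
inductive Route (H : Λ → Subgroup G) (Z : Set G) (ρ f : G → ℝ) (F : Λ → G → ℝ) :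
    G → G → ℕ → ℝ → Prop
  | nil (g) : Route H Z ρ f F g g 0 0
  | gen {g g' n s} (k) : k ∈ Z → Route H Z ρ f F g g' n s →
      Route H Z ρ f F g (g' * k) (n + 1) (s + ρ g' * (f (g' * k) - f g'))
  | per {g g' n s} (l h) : h ∈ H l → Route H Z ρ f F g g' n s →
      Route H Z ρ f F g (g' * h) (n + 1)
        (s + (ρ g' * (F l g' - f g') - ρ (g' * h) * (F l g' - f (g' * h))))

lemma Route.trans {Z : Set G} {ρ f : G → ℝ} {F : Λ → G → ℝ} {a b c : G} {n m : ℕ} {s t : ℝ}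
    (h₁ : Route H Z ρ f F a b n s) (h₂ : Route H Z ρ f F b c m t) :
    Route H Z ρ f F a c (n + m) (s + t) := by
  induction h₂ with
  | nil => simpa using h₁
  | gen k hk _ ih => simpa [add_assoc] using ih.gen k hk
  | per l h hh _ ih => simpa only [add_assoc] using ih.per l h hh

/-- The linear isoperimetric inequality bounds the sums of `ρ df` along closed paths. -/
theorem IsRelHyperbolic.exists_route_bound (hhyp : IsRelHyperbolic H) {Z : Set G} (hZ : Z.Finite)
    (L : G → ℝ) :
    ∃ K : ℝ, 0 ≤ K ∧ ∀ ρ f F, IsTame H L ρ f F → ∀ g n s, Route H Z ρ f F g g n s →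
      |s| ≤ K * (n + 1) := by
  obtain ⟨X, Rl, hpres, A, B, hiso⟩ := hhyp
  have hRl : Rl ⊆ (relEps H X).ker := hpres.ker ▸ Subgroup.subset_normalClosure
  choose M hM using flow_approx (H := H) (X := X) L
  obtain ⟨N₀, hN₀⟩ := (hpres.finR.image M).bddAbove
  let N := max N₀ 0
  have hN : ∀ r ∈ Rl, ∀ ρ f F, IsTame H L ρ f F → ∀ g, |(flow H X ρ f F r).sum g| ≤ N := by
    intro r hr ρ f F hT g
    have h1 := hM r ρ f F hT g
    have h2 : relEps H X r = 1 := hRl hr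
    rw [h2, mul_one, sub_self, mul_zero, sub_zero] at h1
    exact h1.trans ((hN₀ ⟨r, hr, rfl⟩).trans (le_max_left _ _))
  have hlift : ∀ k : G, ∃ w : List (RelLetter H X), relEps H X (wordToF w) = k := by
    intro k
    obtain ⟨e, rfl⟩ := hpres.surj k
    obtain ⟨w, rfl⟩ := exists_wordToF e
    exact ⟨w, rfl⟩
  choose W hW using hlift
  obtain ⟨T₀, hT₀⟩ := (hZ.image fun k => (W k).length).bddAbove
  let T := T₀ + 1
  obtain ⟨E₀, hE₀⟩ := (hZ.image fun k => M (wordToF (W k))).bddAbove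
  let E := max E₀ 0
  have hroute : ∀ ρ f F, IsTame H L ρ f F → ∀ g g' n s, Route H Z ρ f F g g' n s →
      ∃ w : List (RelLetter H X), g * relEps H X (wordToF w) = g' ∧ w.length ≤ T * n ∧
        |(flow H X ρ f F (wordToF w)).sum g - s| ≤ E * n := by
    intro ρ f F hT g g' n s hr
    induction hr with
    | nil => exact ⟨[], by simp [wordToF]⟩
    | @gen g' n s k hk _ ih =>
      obtain ⟨w, rfl, hl, hs⟩ := ih
      refine ⟨w ++ W k, by simp [wordToF_append, hW, mul_assoc], ?_, ?_⟩
      · have h1 : (W k).length ≤ T := (hT₀ ⟨k, hk, rfl⟩).trans (Nat.le_succ _)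
        rw [List.length_append, mul_add, mul_one]
        exact add_le_add hl h1
      · have h1 := hM (wordToF (W k)) ρ f F hT (g * relEps H X (wordToF w))
        have h2 : M (wordToF (W k)) ≤ E := (hE₀ ⟨k, hk, rfl⟩).trans (le_max_left _ _)
        rw [hW] at h1
        rw [wordToF_append, map_mul, PathSum.mul_sum, flow_disp]
        push_cast
        rw [abs_le] at *
        constructor <;> linarith
    | @per g' n s l h hh _ ih =>
      obtain ⟨w, rfl, hl, hs⟩ := ih
      have hE : 0 ≤ E := le_max_right _ _
      by_cases h1 : h = 1
      · refine ⟨w, by simp [h1], hl.trans (Nat.mul_le_mul_left _ (Nat.le_succ _)), ?_⟩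
        simp only [h1, mul_one, sub_self, add_zero]
        push_cast
        linarith
      · let a : RelLetter H X := .inl ⟨l, ⟨h, hh⟩, by simpa [Subtype.ext_iff] using h1⟩
        have ha : wordToF [a] = Monoid.Coprod.inl (Monoid.CoprodI.of (M := fun l => H l) ⟨h, hh⟩) := by
          simp [wordToF, RelLetter.toF, a]
        have hae : relEps H X (wordToF [a]) = h := by
          rw [ha]
          simp [relEps]
        refine ⟨w ++ [a], by rw [wordToF_append, map_mul, hae, mul_assoc], ?_, ?_⟩
        · rw [List.length_append, mul_add, mul_one]
          exact add_le_add hl (Nat.le_add_left 1 T₀)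
        · rw [wordToF_append, map_mul, PathSum.mul_sum, flow_disp, ha, flow_per]
          simp only [hT.cone_mul l _ h hh]
          push_cast
          rw [abs_le] at *
          constructor <;> linarith
  refine ⟨N * (A * T + B) + E, by positivity, fun ρ f F hT g n s hr => ?_⟩
  obtain ⟨w, hw, hl, hs⟩ := hroute ρ f F hT g g n s hr
  have hw1 : relEps H X (wordToF w) = 1 := by simpa using hw
  obtain ⟨k, hk, r, c, hrc, heq⟩ := hiso w hw1
  have h1 := flow_prod_conj_le hRl (fun r hr g => hN r hr ρ f F hT g)
    (List.ofFn fun i => (c i)⁻¹ * r i * c i) (by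
      intro e he
      obtain ⟨i, rfl⟩ := (List.mem_ofFn' _ _).1 he
      exact ⟨r i, hrc i, c i, rfl⟩) g
  rw [← heq, List.length_ofFn] at h1
  have h2 : (k : ℝ) ≤ A * (T * n) + B := by
    have : k ≤ A * (T * n) + B := hk.trans (Nat.add_le_add_right (Nat.mul_le_mul_left A hl) B)
    exact_mod_cast this
  have h3 : N * k ≤ N * (A * (T * n) + B) :=
    mul_le_mul_of_nonneg_left h2 (le_max_right _ _)
  have h4 : 0 ≤ N * (A * T) + N * B * n + E := by positivity
  have h5 : |s| ≤ N * k + E * n := by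
    rw [abs_le] at *
    constructor <;> linarith
  linarith

end Flow

section Crossing

variable {G : Type*} [Group G] {Λ : Type*} {H : Λ → Subgroup G} {X : Set G}

/-- The distance from `a` to the cone point of the coset `g H_l`, up to an additive constant. -/
noncomputable def coneDist (H : Λ → Subgroup G) (X : Set G) (a : G) (l : Λ) (g : G) : ℕ :=
  sInf {n | ∃ h ∈ H l, n = relDist H X a (g * h)} + 1

lemma coneDist_le (a : G) (l : Λ) (g : G) : coneDist H X a l g ≤ relDist H X a g + 1 :=
  Nat.succ_le_succ (Nat.sInf_le ⟨1, (H l).one_mem, by simp⟩)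

lemma le_coneDist (hX : Subgroup.closure X = ⊤) (a : G) (l : Λ) (g : G) :
    relDist H X a g ≤ coneDist H X a l g := by
  obtain ⟨h, hh, he⟩ := Nat.sInf_mem (s := {n | ∃ h ∈ H l, n = relDist H X a (g * h)})
    ⟨_, 1, (H l).one_mem, rfl⟩
  have h1 := relDist_triangle (H := H) hX a (g * h) g
  have h2 := relDist_mul_le_one (X := X) hh g
  rw [relDist_comm hX] at h2
  unfold coneDist
  omega

lemma coneDist_mul (a : G) {l : Λ} {h : G} (hh : h ∈ H l) (g : G) :
    coneDist H X a l (g * h) = coneDist H X a l g := by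
  unfold coneDist
  congr 2
  ext n
  constructor
  · rintro ⟨k, hk, rfl⟩
    exact ⟨h * k, (H l).mul_mem hh hk, by rw [mul_assoc]⟩
  · rintro ⟨k, hk, rfl⟩
    exact ⟨h⁻¹ * k, (H l).mul_mem ((H l).inv_mem hh) hk, by rw [mul_assoc, mul_inv_cancel_left]⟩

lemma abs_relDist_mul_sub_le (hX : Subgroup.closure X = ⊤) (a g k : G) :
    |(relDist H X a (g * k) : ℝ) - relDist H X a g| ≤ wordLength X k := by
  have h1 := relDist_triangle (H := H) hX a g (g * k)
  have h2 := relDist_triangle (H := H) hX a (g * k) g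
  have h3 := relDist_mul_le_wordLength (H := H) hX g k
  rw [relDist_comm hX (g * k) g] at h2
  rw [abs_le, neg_le_sub_iff_le_add, sub_le_iff_le_add']
  norm_cast
  omega

lemma abs_xDist_mul_sub_le (hX : Subgroup.closure X = ⊤) (a g k : G) :
    |(xDist X a (g * k) : ℝ) - xDist X a g| ≤ wordLength X k := by
  have hm : ∀ x : G, x ∈ Subgroup.closure X := fun x => hX ▸ Subgroup.mem_top x
  have h1 : xDist X a (g * k) ≤ xDist X a g + wordLength X k := by
    simpa [xDist, mul_assoc] using wordLength_mul_le (hm (a⁻¹ * g)) (hm k)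
  have h2 : xDist X a g ≤ xDist X a (g * k) + wordLength X k := by
    simpa [xDist, mul_assoc, wordLength_inv (hm k)] using
      wordLength_mul_le (hm (a⁻¹ * (g * k))) (hm k⁻¹)
  rify at h1 h2
  rw [abs_le]
  constructor <;> linarith

lemma abs_cutoff_sub_le {E : G → ℝ} {L : G → ℝ} (hE : ∀ g k, |E (g * k) - E g| ≤ L k)
    (s : ℝ) (g k : G) : |max (s - E (g * k)) 0 - max (s - E g) 0| ≤ L k := by
  refine (abs_max_sub_max_le_abs _ _ _).trans ?_
  rw [sub_sub_sub_cancel_left, abs_sub_comm]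
  exact hE g k

lemma isTame_relDist (hX : Subgroup.closure X = ⊤) {c : ℕ → ℝ}
    (hc : ∀ m n : ℕ, |c m - c n| ≤ |(m : ℝ) - n|) {ρ : G → ℝ}
    (hρ : ∀ g k, |ρ (g * k) - ρ g| ≤ wordLength X k) (a : G) :
    IsTame H (fun k => wordLength X k) ρ (fun g => c (relDist H X a g))
      (fun l g => c (coneDist H X a l g)) where
  weight := hρ
  height g k := (hc _ _).trans (abs_relDist_mul_sub_le hX a g k)
  cone l g := by
    refine (hc _ _).trans ?_
    have h1 := coneDist_le (H := H) (X := X) a l g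
    have h2 := le_coneDist (H := H) hX a l g
    rw [abs_le, neg_le_sub_iff_le_add, sub_le_iff_le_add']
    norm_cast
    omega
  cone_mul l g h hh := by rw [coneDist_mul a hh]

/-- The form `ρ df` vanishes on paths inside `P`. -/
def VanishesOn (ρ f : G → ℝ) (F : Λ → G → ℝ) (P : Set G) : Prop :=
  (∀ w ∈ P, ρ w = 0) ∨ ∃ c, ∀ w ∈ P, f w = c ∧ ∀ l, F l w = c

variable {Z : Set G} {ρ f : G → ℝ} {F : Λ → G → ℝ}

lemma VanishesOn.route {P : Set G} (hP : VanishesOn ρ f F P) (u : G) (w : List G)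
    (hw : ∀ x ∈ w, x ∈ Z ∨ ∃ l, x ∈ H l) (hpre : ∀ v, v <+: w → u * v.prod ∈ P) :
    Route H Z ρ f F u (u * w.prod) w.length 0 := by
  induction w using List.reverseRecOn with
  | nil => simpa using Route.nil u
  | append_singleton w x ih =>
    have h1 := ih (fun y hy => hw y (List.mem_append_left _ hy))
      fun v hv => hpre v (hv.trans (List.prefix_append _ _))
    have hm := hpre w (List.prefix_append _ _)
    have hm' : u * w.prod * x ∈ P := by
      simpa [mul_assoc] using hpre (w ++ [x]) (List.prefix_refl _)
    rw [List.prod_append, List.prod_singleton, ← mul_assoc, List.length_append]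
    rcases hw x (by simp) with hx | ⟨l, hx⟩
    · have h2 := h1.gen x hx
      rcases hP with h0 | ⟨c, hc⟩
      · simpa [h0 _ hm] using h2
      · simpa [(hc _ hm).1, (hc _ hm').1] using h2
    · have h2 := h1.per l x hx
      rcases hP with h0 | ⟨c, hc⟩
      · simpa [h0 _ hm, h0 _ hm'] using h2
      · simpa [(hc _ hm).1, (hc _ hm').1, (hc _ hm).2] using h2

lemma VanishesOn.route_relDist (hX : Subgroup.closure X = ⊤)
    (hXZ : ∀ x, x ∈ X ∨ x⁻¹ ∈ X → x ∈ Z) {u v : G}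
    (hP : VanishesOn ρ f F {w | relDist H X u w ≤ relDist H X u v}) :
    Route H Z ρ f F u v (relDist H X u v) 0 := by
  obtain ⟨w, hwl, hw, hp⟩ := exists_word_of_mem_closure
    (S := X ∪ ⋃ l, (H l : Set G)) (g := u⁻¹ * v) (by rw [closure_union_eq_top hX]; trivial)
  have hwl' : w.length = relDist H X u v := hwl
  rw [← hwl', show v = u * w.prod by simp [hp]]
  refine hP.route u w (fun x hx => ?_) fun v' hv' => ?_
  · have := hw x hx
    simp only [Set.mem_union, Set.mem_iUnion, SetLike.mem_coe, inv_mem_iff] at this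
    grind
  · change relDist H X u _ ≤ _
    rw [← hwl', relDist, inv_mul_cancel_left]
    exact (wordLength_le fun x hx => hw x (hv'.subset hx)).trans hv'.length_le

lemma route_subgroup {Y : Set G} {R : Subgroup G} (hYR : Subgroup.closure Y = R)
    (hYZ : ∀ x, x ∈ Y ∨ x⁻¹ ∈ Y → x ∈ Z) (hρ : ∀ r ∈ R, ρ r = 0) {a b : G} (ha : a ∈ R)
    (hb : b ∈ R) : Route H Z ρ f F a b (wordLength Y (a⁻¹ * b)) 0 := by
  have hab : a⁻¹ * b ∈ Subgroup.closure Y := hYR ▸ R.mul_mem (R.inv_mem ha) hb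
  obtain ⟨w, hwl, hw, hp⟩ := exists_word_of_mem_closure hab
  rw [← hwl, show b = a * w.prod by simp [hp]]
  have hP : VanishesOn ρ f F (R : Set G) := .inl hρ
  refine hP.route a w (fun x hx => .inl (hYZ x (hw x hx))) fun v hv => ?_
  refine R.mul_mem ha (R.list_prod_mem fun x hx => ?_)
  rw [← hYR]
  rcases hw x (hv.subset hx) with h | h
  · exact Subgroup.subset_closure h
  · exact inv_mem_iff.1 (Subgroup.subset_closure h)

lemma IsGeodesic.route {p : RelPath H X} (hp : IsGeodesic p) (hX : Subgroup.closure X = ⊤)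
    (hXZ : ∀ x, x ∈ X ∨ x⁻¹ ∈ X → x ∈ Z) (c : ℕ → ℝ) {i j : ℕ} (hij : i ≤ j) (hj : j ≤ p.len) :
    Route H Z ρ (fun g => c (relDist H X p.start g)) (fun l g => c (coneDist H X p.start l g))
      (p.vertex i) (p.vertex j) (j - i)
      (∑ t ∈ Finset.Ico i j, ρ (p.vertex t) * (c (t + 1) - c t)) := by
  have hd : ∀ t ≤ p.len, relDist H X p.start (p.vertex t) = t := fun t ht => by
    simpa using (hp 0 t (Nat.zero_le _) ht).symm
  induction j, hij using Nat.le_induction with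
  | base => simpa using Route.nil _
  | succ j hij ih =>
    have h1 := ih (by omega)
    have hjl : j < p.len := hj
    have hd0 := hd j hjl.le
    have hd1 := hd (j + 1) hj
    rw [Finset.sum_Ico_succ_top hij, show j + 1 - i = j - i + 1 by omega]
    rw [p.vertex_succ hjl] at hd1 ⊢
    have hgen : ∀ k ∈ Z, k = (p.word[j]'hjl).val → Route H Z ρ
        (fun g => c (relDist H X p.start g)) (fun l g => c (coneDist H X p.start l g))
        (p.vertex i) (p.vertex j * (p.word[j]'hjl).val) (j - i + 1)
        (∑ t ∈ Finset.Ico i j, ρ (p.vertex t) * (c (t + 1) - c t) +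
          ρ (p.vertex j) * (c (j + 1) - c j)) := by
      rintro k hk rfl
      convert h1.gen _ hk using 2
      rw [hd0, hd1]
    rcases (p.word[j]'hjl).val_mem with h | h | ⟨l, h⟩
    · exact hgen _ (hXZ _ (.inl h)) rfl
    · exact hgen _ (hXZ _ (.inr h)) rfl
    · convert h1.per l _ h using 2
      have h2 := coneDist_le (H := H) (X := X) p.start l (p.vertex j)
      have h3 := le_coneDist (H := H) hX p.start l (p.vertex j * (p.word[j]'hjl).val)
      rw [coneDist_mul _ h] at h3
      have h4 : coneDist H X p.start l (p.vertex j) = j + 1 := by omega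
      rw [hd0, hd1, h4]
      ring

/-- If a geodesic starts and ends near `R`, then the sum of `ρ df` along it is controlled by the
length of the loop obtained by closing it up through `R`. -/
lemma exists_crossing_bound (hhyp : IsRelHyperbolic H) (hXfin : X.Finite)
    (hX : Subgroup.closure X = ⊤) {R : Subgroup G} {Y : Set G} (hYfin : Y.Finite)
    (hYR : Subgroup.closure Y = R) :
    ∃ K : ℝ, 0 ≤ K ∧ ∀ p : RelPath H X, IsGeodesic p → ∀ c : ℕ → ℝ,
      (∀ m n : ℕ, |c m - c n| ≤ |(m : ℝ) - n|) → ∀ ρ : G → ℝ,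
      (∀ g k, |ρ (g * k) - ρ g| ≤ wordLength X k) → (∀ r ∈ R, ρ r = 0) →
      ∀ i j, i ≤ j → j ≤ p.len → ∀ a ∈ R, ∀ b ∈ R,
      (a = p.vertex i ∨ VanishesOn ρ (fun g => c (relDist H X p.start g))
        (fun l g => c (coneDist H X p.start l g))
        {w | relDist H X a w ≤ relDist H X a (p.vertex i)}) →
      (b = p.vertex j ∨ VanishesOn ρ (fun g => c (relDist H X p.start g))
        (fun l g => c (coneDist H X p.start l g))
        {w | relDist H X (p.vertex j) w ≤ relDist H X (p.vertex j) b}) →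
      ∑ t ∈ Finset.Ico i j, ρ (p.vertex t) * (c (t + 1) - c t) ≤
        K * ((relDist H X a (p.vertex i) + (j - i) + relDist H X (p.vertex j) b +
          wordLength Y (b⁻¹ * a) : ℕ) + 1) := by
  let Z : Set G := (X ∪ X⁻¹) ∪ (Y ∪ Y⁻¹)
  have hZ : Z.Finite := (hXfin.union hXfin.inv).union (hYfin.union hYfin.inv)
  have hXZ : ∀ x, x ∈ X ∨ x⁻¹ ∈ X → x ∈ Z := fun x hx => .inl hx
  have hYZ : ∀ x, x ∈ Y ∨ x⁻¹ ∈ Y → x ∈ Z := fun x hx => .inr hx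
  obtain ⟨K, hK, hbound⟩ := hhyp.exists_route_bound hZ fun k => wordLength X k
  refine ⟨K, hK, fun p hp c hc ρ hρ hρR i j hij hj a ha b hb hai hbj => ?_⟩
  have hT := isTame_relDist (H := H) hX hc hρ p.start
  have r1 : Route H Z ρ (fun g => c (relDist H X p.start g))
      (fun l g => c (coneDist H X p.start l g)) a (p.vertex i)
      (relDist H X a (p.vertex i)) 0 := by
    rcases hai with rfl | h
    · simpa using Route.nil _
    · exact h.route_relDist hX hXZ
  have r3 : Route H Z ρ (fun g => c (relDist H X p.start g))
      (fun l g => c (coneDist H X p.start l g)) (p.vertex j) b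
      (relDist H X (p.vertex j) b) 0 := by
    rcases hbj with rfl | h
    · simpa using Route.nil _
    · exact h.route_relDist hX hXZ
  have h := hbound _ _ _ hT _ _ _ (((r1.trans (hp.route hX hXZ c hij hj)).trans r3).trans
    (route_subgroup hYR hYZ hρR hb ha))
  rw [zero_add, add_zero, add_zero] at h
  exact (le_abs_self _).trans h

lemma exists_relDist_bound (hhyp : IsRelHyperbolic H) (hXfin : X.Finite)
    (hX : Subgroup.closure X = ⊤) {R : Subgroup G} {Y : Set G} (hYfin : Y.Finite)
    (hYR : Subgroup.closure Y = R) {C : ℝ} (hC : 0 ≤ C)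
    (hYC : ∀ a ∈ R, ∀ b ∈ R, (wordLength Y (a⁻¹ * b) : ℝ) ≤ C * (relDist H X a b + 1)) :
    ∃ D₀ : ℕ, ∀ p : RelPath H X, IsGeodesic p → p.start ∈ R → p.finish ∈ R →
      ∀ k ≤ p.len, ∃ r ∈ R, relDist H X (p.vertex k) r ≤ D₀ := by
  obtain ⟨K, hK, hbound⟩ := exists_crossing_bound hhyp hXfin hX hYfin hYR
  refine ⟨⌈50 * (K * (1 + C)) + 1⌉₊, fun p hp hs hf => ?_⟩
  have hf' : p.vertex p.len ∈ R := hf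
  let δ : G → ℕ := fun u => sInf {n | ∃ r ∈ R, n = relDist H X u r}
  have hδ : ∀ u, ∃ r ∈ R, relDist H X u r = δ u := fun u => by
    obtain ⟨r, hr, h⟩ := Nat.sInf_mem (s := {n | ∃ r ∈ R, n = relDist H X u r})
      ⟨_, 1, R.one_mem, rfl⟩
    exact ⟨r, hr, h.symm⟩
  have hδle : ∀ u, ∀ r ∈ R, δ u ≤ relDist H X u r := fun u r hr => Nat.sInf_le ⟨r, hr, rfl⟩
  obtain ⟨k, hk, hmax⟩ := Finset.exists_max_image (Finset.range (p.len + 1))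
    (fun k => δ (p.vertex k)) ⟨0, by simp⟩
  have hk' : k ≤ p.len := by simpa [Nat.lt_succ_iff] using hk
  obtain ⟨D, hD⟩ : ∃ D, D = δ (p.vertex k) := ⟨_, rfl⟩
  have hDmax : ∀ t ≤ p.len, δ (p.vertex t) ≤ D := fun t ht => by
    rw [hD]
    exact hmax t (by simpa [Nat.lt_succ_iff] using ht)
  suffices hfin : (D : ℝ) ≤ 50 * (K * (1 + C)) + 1 by
    intro t ht
    obtain ⟨r, hr, h⟩ := hδ (p.vertex t)
    refine ⟨r, hr, h ▸ (hDmax t ht).trans ?_⟩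
    exact_mod_cast hfin.trans (Nat.le_ceil _)
  have hkl : D ≤ p.len - k := by
    rw [hp k p.len hk' le_rfl, hD]
    exact hδle _ _ hf'
  let ρ : G → ℝ := fun g => max ((D : ℝ) - relDist H X (p.vertex k) g) 0
  have hρ0 : ∀ g, D ≤ relDist H X (p.vertex k) g → ρ g = 0 := fun g hg =>
    max_eq_right (sub_nonpos.2 (by exact_mod_cast hg))
  obtain ⟨i, hi⟩ : ∃ i, i = k - 3 * D := ⟨_, rfl⟩
  obtain ⟨j, hj⟩ : ∃ j, j = min (k + 3 * D) p.len := ⟨_, rfl⟩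
  have hA : ∃ a ∈ R, relDist H X a (p.vertex i) ≤ D ∧ (a = p.vertex i ∨
      ∀ w, relDist H X a w ≤ relDist H X a (p.vertex i) → ρ w = 0) := by
    by_cases h0 : i = 0
    · exact ⟨p.start, hs, by simp [h0], .inl (by simp [h0])⟩
    · obtain ⟨a, ha, had⟩ := hδ (p.vertex i)
      have h1 := hDmax i (by omega)
      rw [relDist_comm hX] at had
      refine ⟨a, ha, by omega, .inr fun w hw => hρ0 w ?_⟩
      have h2 := hp i k (by omega) hk'
      have h3 := relDist_triangle (H := H) hX (p.vertex i) a (p.vertex k)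
      have h4 := relDist_triangle (H := H) hX a w (p.vertex k)
      rw [relDist_comm hX (p.vertex i) a] at h3
      rw [relDist_comm hX w] at h4
      omega
  have hB : ∃ b ∈ R, relDist H X (p.vertex j) b ≤ D ∧ (b = p.vertex j ∨
      ∀ w, relDist H X (p.vertex j) w ≤ relDist H X (p.vertex j) b → ρ w = 0) := by
    by_cases h0 : j = p.len
    · exact ⟨p.finish, hf, by rw [h0]; exact (relDist_self _).trans_le (Nat.zero_le _),
        .inl (by rw [h0]; rfl)⟩
    · obtain ⟨b, hb, hbd⟩ := hδ (p.vertex j)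
      have h1 := hDmax j (by omega)
      refine ⟨b, hb, by omega, .inr fun w hw => hρ0 w ?_⟩
      have h2 := hp k j (by omega) (by omega)
      have h3 := relDist_triangle (H := H) hX (p.vertex k) w (p.vertex j)
      rw [relDist_comm hX w] at h3
      omega
  obtain ⟨a, ha, had, haz⟩ := hA
  obtain ⟨b, hb, hbd, hbz⟩ := hB
  have hρl : ∀ g k, |ρ (g * k) - ρ g| ≤ wordLength X k :=
    abs_cutoff_sub_le (E := fun g => (relDist H X (p.vertex k) g : ℝ))
      (L := fun g => (wordLength X g : ℝ)) (abs_relDist_mul_sub_le hX _) D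
  have hmain := hbound p hp (fun n => n) (fun m n => le_rfl) ρ hρl
    (fun r hr => hρ0 r (hD ▸ hδle _ r hr)) i j (by omega) (by omega) a ha b hb
    (haz.imp_right .inl) (hbz.imp_right .inl)
  have hba : relDist H X b a ≤ 8 * D := by
    have h1 := relDist_triangle (H := H) hX a (p.vertex i) b
    have h2 := relDist_triangle (H := H) hX (p.vertex i) (p.vertex j) b
    have h3 := hp i j (by omega) (by omega)
    rw [relDist_comm hX]
    omega
  have hw : (wordLength Y (b⁻¹ * a) : ℝ) ≤ C * (8 * D + 1) := by
    refine (hYC b hb a ha).trans (mul_le_mul_of_nonneg_left ?_ hC)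
    exact_mod_cast Nat.succ_le_succ hba
  have hlen : ((relDist H X a (p.vertex i) + (j - i) + relDist H X (p.vertex j) b : ℕ) : ℝ) ≤
      8 * D := by
    have : relDist H X a (p.vertex i) + (j - i) + relDist H X (p.vertex j) b ≤ 8 * D := by omega
    exact_mod_cast this
  obtain ⟨E, hE⟩ : ∃ E, E = D / 2 := ⟨_, rfl⟩
  have hlow : (E : ℝ) * E ≤
      ∑ t ∈ Finset.Ico i j, ρ (p.vertex t) * (((t + 1 : ℕ) : ℝ) - (t : ℕ)) := by
    have hρn : ∀ t, 0 ≤ ρ (p.vertex t) * (((t + 1 : ℕ) : ℝ) - (t : ℕ)) := fun t => by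
      push_cast
      rw [add_sub_cancel_left, mul_one]
      exact le_max_right _ _
    refine le_trans ?_ (Finset.sum_le_sum_of_subset_of_nonneg
      (s := Finset.Ico k (k + E)) (Finset.Ico_subset_Ico (by omega) (by omega))
      fun t _ _ => hρn t)
    have hcard := Finset.card_nsmul_le_sum (Finset.Ico k (k + E))
      (fun t => ρ (p.vertex t) * (((t + 1 : ℕ) : ℝ) - (t : ℕ))) E fun t ht => by
        rw [Finset.mem_Ico] at ht
        have h1 := hp k t ht.1 (by omega)
        have h2 : E + relDist H X (p.vertex k) (p.vertex t) ≤ D := by omega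
        have h3 : (E : ℝ) + relDist H X (p.vertex k) (p.vertex t) ≤ D := by exact_mod_cast h2
        push_cast
        rw [add_sub_cancel_left, mul_one]
        exact le_max_of_le_left (by linarith)
    simpa using hcard
  have hDE : (D : ℝ) ≤ 2 * E + 1 := by
    have : D ≤ 2 * E + 1 := by omega
    exact_mod_cast this
  have hup : (E : ℝ) * E ≤ K * (1 + C) * (16 * E + 9) := by
    refine (hlow.trans hmain).trans ?_
    rw [mul_assoc]
    refine mul_le_mul_of_nonneg_left ?_ hK
    push_cast at hlen ⊢
    nlinarith
  have hKC : 0 ≤ K * (1 + C) := by positivity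
  rcases Nat.eq_zero_or_pos E with h0 | h0
  · rw [h0] at hDE
    push_cast at hDE
    linarith
  · have hE1 : (1 : ℝ) ≤ E := by exact_mod_cast h0
    have hEle : (E : ℝ) ≤ 25 * (K * (1 + C)) := by
      by_contra! hcon
      nlinarith
    linarith

lemma relQuasiconvex_of_wordLength_le (hhyp : IsRelHyperbolic H) (hXfin : X.Finite)
    (hX : Subgroup.closure X = ⊤) {R : Subgroup G} {Y : Set G} (hYfin : Y.Finite)
    (hYR : Subgroup.closure Y = R) {C : ℝ} (hC : 0 ≤ C)
    (hYC : ∀ a ∈ R, ∀ b ∈ R, (wordLength Y (a⁻¹ * b) : ℝ) ≤ C * (relDist H X a b + 1)) :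
    RelQuasiconvex H X R := by
  obtain ⟨K, hK, hbound⟩ := exists_crossing_bound hhyp hXfin hX hYfin hYR
  obtain ⟨D, hD⟩ := exists_relDist_bound hhyp hXfin hX hYfin hYR hC hYC
  refine ⟨K * (1 + C) * (5 * D + 3) + 1, by positivity, fun p hp hs hf k hk => ?_⟩
  have hf' : p.vertex p.len ∈ R := hf
  obtain ⟨w, hw, hwmin⟩ : ∃ w ∈ R, ∀ r ∈ R, xDist X (p.vertex k) w ≤ xDist X (p.vertex k) r := by
    obtain ⟨w, hw, h⟩ := Nat.sInf_mem (s := {n | ∃ r ∈ R, n = xDist X (p.vertex k) r})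
      ⟨_, 1, R.one_mem, rfl⟩
    exact ⟨w, hw, fun r hr => h ▸ Nat.sInf_le ⟨r, hr, rfl⟩⟩
  refine ⟨w, hw, ?_⟩
  rcases hk.eq_or_lt with rfl | hkl
  · have h0 : xDist X (p.vertex p.len) w ≤ 0 := by simpa [xDist] using hwmin _ hf'
    rw [Nat.le_zero.1 h0]
    push_cast
    positivity
  let ρ : G → ℝ := fun g => max ((xDist X (p.vertex k) w : ℝ) - xDist X (p.vertex k) g) 0
  have hρR : ∀ r ∈ R, ρ r = 0 := fun r hr =>
    max_eq_right (sub_nonpos.2 (by exact_mod_cast hwmin r hr))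
  let c : ℕ → ℝ := fun n => if n ≤ k then 0 else 1
  have hc : ∀ m n : ℕ, |c m - c n| ≤ |(m : ℝ) - n| := by
    have key : ∀ m n : ℕ, m ≠ n → (1 : ℝ) ≤ |(m : ℝ) - n| := fun m n h => by
      have : (1 : ℤ) ≤ |(m : ℤ) - n| := Int.one_le_abs (by omega)
      exact_mod_cast this
    intro m n
    simp only [c]
    split_ifs with h1 h2 h2
    · simp
    · simpa using key m n (by omega)
    · simpa using key m n (by omega)
    · simp
  have hc0 : ∀ n ≤ k, c n = 0 := fun n hn => if_pos hn
  have hc1 : ∀ n, k < n → c n = 1 := fun n hn => if_neg (by omega)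
  obtain ⟨i, hi⟩ : ∃ i, i = k - (2 * D + 1) := ⟨_, rfl⟩
  obtain ⟨j, hj⟩ : ∃ j, j = min (k + D + 1) p.len := ⟨_, rfl⟩
  have hA : ∃ a ∈ R, relDist H X a (p.vertex i) ≤ D ∧ (a = p.vertex i ∨
      VanishesOn ρ (fun g => c (relDist H X p.start g))
        (fun l g => c (coneDist H X p.start l g))
        {w | relDist H X a w ≤ relDist H X a (p.vertex i)}) := by
    by_cases h0 : i = 0
    · exact ⟨p.start, hs, by simp [h0], .inl (by simp [h0])⟩
    · obtain ⟨a, ha, had⟩ := hD p hp hs hf i (by omega)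
      rw [relDist_comm hX] at had
      refine ⟨a, ha, had, .inr (.inr ⟨0, fun u hu => ?_⟩)⟩
      have hu' : relDist H X a u ≤ relDist H X a (p.vertex i) := hu
      have h1 := hp 0 i (by omega) (by omega)
      rw [p.vertex_zero] at h1
      have h2 := relDist_triangle (H := H) hX p.start (p.vertex i) u
      have h3 := relDist_triangle (H := H) hX (p.vertex i) a u
      rw [relDist_comm hX (p.vertex i) a] at h3
      refine ⟨hc0 _ (by omega), fun l => hc0 _ ?_⟩
      have h4 := coneDist_le (H := H) (X := X) p.start l u
      omega
  have hB : ∃ b ∈ R, relDist H X (p.vertex j) b ≤ D ∧ (b = p.vertex j ∨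
      VanishesOn ρ (fun g => c (relDist H X p.start g))
        (fun l g => c (coneDist H X p.start l g))
        {w | relDist H X (p.vertex j) w ≤ relDist H X (p.vertex j) b}) := by
    by_cases h0 : j = p.len
    · exact ⟨p.finish, hf, by rw [h0]; exact (relDist_self _).trans_le (Nat.zero_le _),
        .inl (by rw [h0]; rfl)⟩
    · obtain ⟨b, hb, hbd⟩ := hD p hp hs hf j (by omega)
      refine ⟨b, hb, hbd, .inr (.inr ⟨1, fun u hu => ?_⟩)⟩
      have hu' : relDist H X (p.vertex j) u ≤ relDist H X (p.vertex j) b := hu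
      have h1 := hp 0 j (by omega) (by omega)
      rw [p.vertex_zero] at h1
      have h2 := relDist_triangle (H := H) hX p.start u (p.vertex j)
      rw [relDist_comm hX u] at h2
      refine ⟨hc1 _ (by omega), fun l => hc1 _ ?_⟩
      have h4 := le_coneDist (H := H) hX p.start l u
      omega
  obtain ⟨a, ha, had, haz⟩ := hA
  obtain ⟨b, hb, hbd, hbz⟩ := hB
  have hρl : ∀ g x, |ρ (g * x) - ρ g| ≤ wordLength X x :=
    abs_cutoff_sub_le (E := fun g => (xDist X (p.vertex k) g : ℝ))
      (L := fun g => (wordLength X g : ℝ)) (abs_xDist_mul_sub_le hX _) _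
  have hmain := hbound p hp c hc ρ hρl hρR i j (by omega) (by omega) a ha b hb haz hbz
  have hsum : ∑ t ∈ Finset.Ico i j, ρ (p.vertex t) * (c (t + 1) - c t) =
      xDist X (p.vertex k) w := by
    rw [Finset.sum_eq_single k]
    · rw [hc0 k le_rfl, hc1 (k + 1) (by omega)]
      simp [ρ, xDist]
    · intro t _ htk
      rcases lt_or_gt_of_ne htk with h | h
      · simp [hc0 t h.le, hc0 (t + 1) h]
      · simp [hc1 t h, hc1 (t + 1) (by omega)]
    · intro h
      exact absurd (Finset.mem_Ico.2 ⟨by omega, by omega⟩) h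
  have hba : relDist H X b a ≤ 5 * D + 2 := by
    have h1 := relDist_triangle (H := H) hX a (p.vertex i) b
    have h2 := relDist_triangle (H := H) hX (p.vertex i) (p.vertex j) b
    have h3 := hp i j (by omega) (by omega)
    rw [relDist_comm hX]
    omega
  have hwl : (wordLength Y (b⁻¹ * a) : ℝ) ≤ C * (5 * D + 3) := by
    refine (hYC b hb a ha).trans (mul_le_mul_of_nonneg_left ?_ hC)
    exact_mod_cast Nat.succ_le_succ hba
  have hlen : ((relDist H X a (p.vertex i) + (j - i) + relDist H X (p.vertex j) b : ℕ) : ℝ) ≤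
      5 * D + 2 := by
    have : relDist H X a (p.vertex i) + (j - i) + relDist H X (p.vertex j) b ≤ 5 * D + 2 := by
      omega
    exact_mod_cast this
  rw [hsum] at hmain
  refine hmain.trans (le_trans ?_ (le_add_of_nonneg_right zero_le_one))
  rw [mul_assoc]
  refine mul_le_mul_of_nonneg_left ?_ hK
  push_cast at hlen ⊢
  linarith

lemma finite_inter_conj_of_wordLength_le (hX : Subgroup.closure X = ⊤) {R : Subgroup G}
    {Y : Set G} (hYfin : Y.Finite) (hYR : Subgroup.closure Y = R) {C : ℝ} (hC : 0 ≤ C)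
    (hYC : ∀ a ∈ R, ∀ b ∈ R, (wordLength Y (a⁻¹ * b) : ℝ) ≤ C * (relDist H X a b + 1))
    (g : G) (l : Λ) : {x : G | x ∈ R ∧ g * x * g⁻¹ ∈ H l}.Finite := by
  refine (finite_wordLength_le hYfin ⌊C * (wordLength X g⁻¹ + 1 + wordLength X g + 1)⌋₊).subset ?_
  rintro x ⟨hx, hgx⟩
  refine ⟨hYR ▸ hx, Nat.le_floor ?_⟩
  have h1 := hYC 1 R.one_mem x hx
  rw [inv_one, one_mul] at h1
  refine h1.trans (mul_le_mul_of_nonneg_left ?_ hC)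
  have h2 : relDist H X 1 x ≤ wordLength X g⁻¹ + 1 + wordLength X g := by
    have h3 := relDist_triangle (H := H) hX 1 g⁻¹ x
    have h4 := relDist_triangle (H := H) hX g⁻¹ (g⁻¹ * (g * x * g⁻¹)) x
    have h5 := relDist_mul_le_wordLength (H := H) hX 1 g⁻¹
    have h6 := relDist_mul_le_one (X := X) hgx g⁻¹
    have h7 := relDist_mul_le_wordLength (H := H) hX (g⁻¹ * (g * x * g⁻¹)) g
    rw [one_mul] at h5
    rw [show g⁻¹ * (g * x * g⁻¹) * g = x by group] at h7
    omega
  exact_mod_cast Nat.succ_le_succ h2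

end Crossing

end RelHyp

/-- Theorem 4.13. Let `G` be generated by a finite set `X` and hyperbolic
relative to `{H₁,…,H_m}`, and let `R ≤ G`. Then `R` is strongly relatively quasi-convex iff `R`
is generated by a finite set `Y` and the natural embedding `(R, dist_Y) → (G, dist_{X∪𝓗})` is a
quasi-isometric embedding. -/
theorem statement_15 {G : Type*} [Group G] {m : ℕ} (H : Fin m → Subgroup G)
    (X : Set G) (hXfin : X.Finite) (hXgen : Subgroup.closure X = ⊤)
    (hhyp : IsRelHyperbolic H) (R : Subgroup G) :
    StronglyRelQuasiconvex H X R ↔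
      ∃ Y : Set G, Y.Finite ∧ Y ⊆ (R : Set G) ∧ Subgroup.closure Y = R ∧
        ∃ c₁ c₂ : ℝ, 0 < c₁ ∧ 0 ≤ c₂ ∧
          ∀ a ∈ R, ∀ b ∈ R,
            (1 / c₁) * (wordLength Y (a⁻¹ * b) : ℝ) - c₂ ≤ (relDist H X a b : ℝ) ∧
            (relDist H X a b : ℝ) ≤ c₁ * (wordLength Y (a⁻¹ * b) : ℝ) + c₂ := by
  constructor
  · exact fun hR => hR.exists_quasiIsometricEmbedding hXfin hXgen
  · rintro ⟨Y, hYfin, -, hYR, c₁, c₂, hc₁, hc₂, hqi⟩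
    have hYC : ∀ a ∈ R, ∀ b ∈ R,
        (wordLength Y (a⁻¹ * b) : ℝ) ≤ c₁ * (1 + c₂) * (relDist H X a b + 1) := by
      intro a ha b hb
      have h1 := (hqi a ha b hb).1
      rw [one_div, sub_le_iff_le_add, inv_mul_le_iff₀ hc₁] at h1
      refine h1.trans ?_
      rw [mul_assoc]
      refine mul_le_mul_of_nonneg_left ?_ hc₁.le
      nlinarith [mul_nonneg hc₂ (Nat.cast_nonneg (α := ℝ) (relDist H X a b))]
    have hC : 0 ≤ c₁ * (1 + c₂) := by positivity
    exact ⟨relQuasiconvex_of_wordLength_le hhyp hXfin hXgen hYfin hYR hC hYC,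
      finite_inter_conj_of_wordLength_le hXgen hYfin hYR hC hYC⟩
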